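/- Comparison principle, fully nonlinear case: Assume (M), (J1), (J2), (F1)–(F4) hold. If u : ℝ^N → ℝ is a bounded upper semicontinuous viscosity subsolution of F(u,Du,L[u,Du]) = f in ℝ^N and v : ℝ^N → ℝ is a bounded lower semicontinuous viscosity supersolution, then u ≤ v on ℝ^N. -/

import Mathlib

set_option autoImplicit false

open MeasureTheory Filter Topology Metric
open scoped InnerProductSpace ENNReal NNReal

noncomputable section

/-- `ℝ^n` as a Euclidean space. -/
abbrev RE (n : ℕ) : Type := EuclideanSpace ℝ (Fin n)

/-- A modulus of continuity: nonnegative, subadditive, tending to `0` at `0⁺`. -/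
def IsModulus (ω : ℝ → ℝ) : Prop :=
  (∀ s, 0 ≤ ω s) ∧ (∀ s t, ω (s + t) ≤ ω s + ω t) ∧
    Filter.Tendsto ω (𝓝[>] (0 : ℝ)) (𝓝 0)

/-- Boundedness of a real valued function. -/
def Bdd {N : ℕ} (u : RE N → ℝ) : Prop := ∃ C, ∀ x, |u x| ≤ C

/-- Test functions: bounded `C²` functions. -/
def TestFn {N : ℕ} (φ : RE N → ℝ) : Prop := ContDiff ℝ 2 φ ∧ Bdd φ

/-- The quasilinear nonlocal operator `L = L₁ + L₂` acting on a (bounded `C²`)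
function `φ`, where the jumps `j₁, j₂` depend on the gradient `Dφ(x)`. -/
def Lop {N P : ℕ} (μ₁ μ₂ : Measure (RE P)) (j₁ j₂ : RE N → RE P → RE N)
    (φ : RE N → ℝ) (x : RE N) : ℝ :=
  (∫ z, (φ (x + j₁ (gradient φ x) z) - φ x
      - ⟪j₁ (gradient φ x) z, gradient φ x⟫_ℝ) ∂μ₁)
  + ∫ z, (φ (x + j₂ (gradient φ x) z) - φ x) ∂μ₂

/-- Viscosity subsolution of `F(u, Du, L[u,Du]) = f` in `ℝ^N`
(test-function formulation with bounded `C²` test functions and global maxima). -/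
def IsSubSol {N P : ℕ} (μ₁ μ₂ : Measure (RE P)) (j₁ j₂ : RE N → RE P → RE N)
    (F : ℝ → RE N → ℝ → ℝ) (f : RE N → ℝ) (u : RE N → ℝ) : Prop :=
  ∀ φ : RE N → ℝ, TestFn φ → ∀ x : RE N, (∀ y, u y - φ y ≤ u x - φ x) →
    F (u x) (gradient φ x) (Lop μ₁ μ₂ j₁ j₂ φ x) ≤ f x

/-- Viscosity supersolution of `F(u, Du, L[u,Du]) = f` in `ℝ^N`. -/
def IsSuperSol {N P : ℕ} (μ₁ μ₂ : Measure (RE P)) (j₁ j₂ : RE N → RE P → RE N)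
    (F : ℝ → RE N → ℝ → ℝ) (f : RE N → ℝ) (u : RE N → ℝ) : Prop :=
  ∀ φ : RE N → ℝ, TestFn φ → ∀ x : RE N, (∀ y, u x - φ x ≤ u y - φ y) →
    f x ≤ F (u x) (gradient φ x) (Lop μ₁ μ₂ j₁ j₂ φ x)


/-- A bounded upper semicontinuous function is a pointwise limit of continuous majorants
(its Lipschitz sup-convolutions) with the same upper bound. -/
theorem exists_continuous_approx_of_upperSemicontinuous {E : Type*} [PseudoMetricSpace E]
    {u : E → ℝ} {C : ℝ} (hC : ∀ x, |u x| ≤ C) (hu : UpperSemicontinuous u) :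
    ∃ U : ℕ → E → ℝ, (∀ n, Continuous (U n)) ∧ (∀ n x, u x ≤ U n x) ∧ (∀ n x, U n x ≤ C) ∧
      ∀ x, Tendsto (fun n => U n x) atTop (𝓝 (u x)) := by
  have hne : ∀ x : E, Nonempty E := fun x => ⟨x⟩
  have hup : ∀ (n : ℕ) (x y : E), u y - n * dist x y ≤ C := fun n x y => by
    have := (abs_le.1 (hC y)).2
    have : 0 ≤ (n : ℝ) * dist x y := by positivity
    linarith
  have hbdd : ∀ (n : ℕ) (x : E), BddAbove (Set.range fun y => u y - n * dist x y) :=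
    fun n x => ⟨C, by rintro _ ⟨y, rfl⟩; exact hup n x y⟩
  have hle : ∀ (n : ℕ) (x : E), u x ≤ ⨆ y, (u y - n * dist x y) := fun n x => by
    simpa using le_ciSup (hbdd n x) x
  refine ⟨fun n x => ⨆ y, (u y - n * dist x y), fun n => ?_, hle, fun n x => ?_, fun x => ?_⟩
  · refine (LipschitzWith.of_le_add_mul (n : ℝ≥0) fun x x' => ?_).continuous
    have := hne x
    refine ciSup_le fun y => ?_
    have h1 := le_ciSup (hbdd n x') y
    have h2 : (n : ℝ) * dist x' y ≤ n * (dist x x' + dist x y) :=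
      mul_le_mul_of_nonneg_left (by rw [dist_comm x x']; exact dist_triangle _ _ _) (by positivity)
    simp only [NNReal.coe_natCast] at *
    linarith
  · have := hne x
    exact ciSup_le (hup n x)
  · have := hne x
    rw [Metric.tendsto_atTop]
    intro ε hε
    obtain ⟨δ, hδ, hδu⟩ := Metric.eventually_nhds_iff.1 (hu x (u x + ε / 2) (by linarith))
    obtain ⟨n₀, hn₀⟩ := exists_nat_ge (2 * C / δ)
    refine ⟨n₀, fun n hn => ?_⟩
    have hsup : ⨆ y, (u y - n * dist x y) ≤ u x + ε / 2 := by
      refine ciSup_le fun y => ?_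
      rcases lt_or_ge (dist x y) δ with h | h
      · have h1 := hδu (by rwa [dist_comm] at h : dist y x < δ)
        have : 0 ≤ (n : ℝ) * dist x y := by positivity
        linarith
      · have h1 : 2 * C ≤ n₀ * δ := by rwa [div_le_iff₀ hδ] at hn₀
        have h2 : (n₀ : ℝ) * δ ≤ n * dist x y :=
          mul_le_mul (by exact_mod_cast hn) h hδ.le (by positivity)
        have h3 := (abs_le.1 (hC y)).2
        have h4 := (abs_le.1 (hC x)).1
        linarith
    have := hle n x
    rw [Real.dist_eq, abs_lt]
    constructor <;> linarith

/-- Smooth insertion touching at a point: an upper semicontinuous `u` lying strictly below a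
continuous `w` and below a `C²` function `φ` with `φ x = u x` admits a `C²` majorant below `w` and
below `φ + ‖· - x‖²`. -/
theorem exists_contDiff_between_of_touching {N : ℕ} {u w φ : RE N → ℝ} {x : RE N}
    (hu : UpperSemicontinuous u) (hw : Continuous w) (huw : ∀ y, u y < w y)
    (hφ : ContDiff ℝ 2 φ) (huφ : ∀ y, u y ≤ φ y) (hx : φ x = u x) :
    ∃ g : RE N → ℝ, ContDiff ℝ 2 g ∧
      ∀ y, u y ≤ g y ∧ g y ≤ w y ∧ g y ≤ φ y + ‖y - x‖ ^ 2 := by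
  have hφ2 : Continuous fun y => φ y + ‖y - x‖ ^ 2 := by
    have := hφ.continuous
    fun_prop
  obtain ⟨g, hg⟩ := exists_contMDiffMap_forall_mem_convex_of_local (n := 2)
    (modelWithCornersSelf ℝ (RE N))
    (t := fun y => Set.Icc (u y) (min (w y) (φ y + ‖y - x‖ ^ 2))) (fun y => convex_Icc _ _) (by
      intro y
      by_cases hy : y = x
      · subst hy
        have hev : ∀ᶠ y' in 𝓝 y, φ y' < w y' :=
          hφ.continuous.continuousAt.eventually_lt hw.continuousAt (by rw [hx]; exact huw y)
        refine ⟨_, hev, φ, hφ.contMDiff.contMDiffOn, fun y' hy' => ⟨huφ y', le_min hy'.le ?_⟩⟩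
        have : 0 ≤ ‖y' - y‖ ^ 2 := by positivity
        linarith
      · have hpos : 0 < ‖y - x‖ ^ 2 := by
          have := norm_pos_iff.2 (sub_ne_zero.2 hy)
          positivity
        have hlt : u y < min (w y) (φ y + ‖y - x‖ ^ 2) :=
          lt_min (huw y) (by linarith [huφ y])
        obtain ⟨c, hc1, hc2⟩ := exists_between hlt
        have e1 := hu y c hc1
        have e2 := (hw.min hφ2).continuousAt.eventually (lt_mem_nhds hc2)
        refine ⟨_, e1.and e2, fun _ => c, contMDiffOn_const, fun y' hy' => ⟨hy'.1.le, hy'.2.le⟩⟩)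
  refine ⟨g, contMDiff_iff_contDiff.1 g.contMDiff, fun y => ?_⟩
  have := hg y
  exact ⟨this.1, this.2.trans (min_le_left _ _), this.2.trans (min_le_right _ _)⟩

/-- Global quadratic bound on the first order Taylor remainder of a bounded `C²` function. -/
theorem TestFn.exists_remainder_le {N : ℕ} {φ : RE N → ℝ} (hφ : TestFn φ) (x : RE N) :
    ∃ K, ∀ h : RE N, |φ (x + h) - φ x - ⟪h, gradient φ x⟫_ℝ| ≤ K * ‖h‖ ^ 2 := by
  obtain ⟨hφ2, B, hB⟩ := hφ
  have hdiff : Differentiable ℝ φ := hφ2.differentiable (by norm_num)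
  have hin : ∀ h : RE N, ⟪h, gradient φ x⟫_ℝ = fderiv ℝ φ x h := fun h => by
    rw [gradient, real_inner_comm, InnerProductSpace.toDual_symm_apply]
  have hf1 : ContDiffAt ℝ 1 (fderiv ℝ φ) x :=
    (hφ2.fderiv_right (m := 1) (by norm_num)).contDiffAt
  obtain ⟨K, t, ht, hK⟩ := hf1.exists_lipschitzOnWith
  obtain ⟨δ, hδ, hδt⟩ := Metric.mem_nhds_iff.1 ht
  have hB0 : 0 ≤ B := (abs_nonneg _).trans (hB x)
  set Q := ‖fderiv ℝ φ x‖ with hQ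
  have hQ0 : 0 ≤ Q := norm_nonneg _
  refine ⟨K + 2 * B / δ ^ 2 + Q / δ, fun h => ?_⟩
  rw [hin]
  rcases lt_or_ge ‖h‖ δ with hh | hh
  · have key := (convex_closedBall x ‖h‖).norm_image_sub_le_of_norm_fderiv_le' (f := φ)
      (φ := fderiv ℝ φ x) (C := K * ‖h‖) (𝕜 := ℝ) (x := x) (y := x + h) (fun y _ => hdiff y)
      (fun y hy => by
        have hy' : ‖y - x‖ ≤ ‖h‖ := by rwa [mem_closedBall, dist_eq_norm] at hy
        have := hK.norm_sub_le (hδt (by rw [mem_ball, dist_eq_norm]; linarith) : y ∈ t)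
          (mem_of_mem_nhds ht)
        exact this.trans (mul_le_mul_of_nonneg_left hy' K.2))
      (mem_closedBall_self (norm_nonneg _)) (by simp [mem_closedBall, dist_eq_norm])
    simp only [add_sub_cancel_left, Real.norm_eq_abs] at key
    have : 0 ≤ (2 * B / δ ^ 2 + Q / δ) * ‖h‖ ^ 2 := by positivity
    nlinarith
  · have h1 : |φ (x + h) - φ x - fderiv ℝ φ x h| ≤ 2 * B + Q * ‖h‖ := by
      have a1 := hB (x + h)
      have a2 := hB x
      have a3 := (fderiv ℝ φ x).le_opNorm h
      rw [Real.norm_eq_abs] at a3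
      rw [abs_le] at *
      constructor <;> linarith
    have h2 : 2 * B ≤ 2 * B / δ ^ 2 * ‖h‖ ^ 2 := by
      rw [div_mul_eq_mul_div, le_div_iff₀ (by positivity)]
      gcongr
    have h3 : Q * ‖h‖ ≤ Q / δ * ‖h‖ ^ 2 := by
      rw [div_mul_eq_mul_div, le_div_iff₀ (by positivity)]
      nlinarith [mul_nonneg hQ0 (norm_nonneg h)]
    have h4 : 0 ≤ (K : ℝ) * ‖h‖ ^ 2 := by positivity
    linarith

theorem gradient_eq_of_le_add_sq {N : ℕ} {g φ : RE N → ℝ} {x : RE N}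
    (hg : DifferentiableAt ℝ g x) (hφ : DifferentiableAt ℝ φ x) (hx : g x = φ x)
    (hle : ∀ y, g y ≤ φ y + ‖y - x‖ ^ 2) : gradient g x = gradient φ x := by
  have hsq : HasFDerivAt (fun y : RE N => ‖y - x‖ ^ 2) (0 : RE N →L[ℝ] ℝ) x := by
    have := ((hasFDerivAt_id x).sub_const x).norm_sq
    simpa using this
  have hd := (hg.hasFDerivAt.sub hφ.hasFDerivAt).sub hsq
  have hmax : IsLocalMax (fun y => g y - φ y - ‖y - x‖ ^ 2) x :=
    Eventually.of_forall fun y => by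
      have := hle y
      simp only [sub_self, norm_zero]
      linarith
  have h0 := hmax.hasFDerivAt_eq_zero hd
  rw [sub_zero, sub_eq_zero] at h0
  rw [gradient, gradient, h0]

theorem gradient_fun_neg {N : ℕ} (φ : RE N → ℝ) (x : RE N) :
    gradient (fun y => -φ y) x = -gradient φ x := by
  rw [gradient, gradient, fderiv_fun_neg, map_neg]

/-- In the subsolution inequality the first nonlocal term may be replaced by the integral of any
integrable majorant of the increments of `u`, and the second one by the increments of `u`. -/
theorem IsSubSol.le_of_majorant {N P : ℕ} {μ₁ μ₂ : Measure (RE P)} [IsFiniteMeasure μ₂]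
    {j₁ j₂ : RE N → RE P → RE N} {F : ℝ → RE N → ℝ → ℝ} {f u : RE N → ℝ}
    (hsub : IsSubSol μ₁ μ₂ j₁ j₂ F f u) (hub : Bdd u) (husc : UpperSemicontinuous u)
    {φ : RE N → ℝ} (hφ : TestFn φ) {x p : RE N} (hp : gradient φ x = p)
    (hmax : ∀ y, u y - φ y ≤ u x - φ x)
    (hj₁ : Measurable (j₁ p)) (hj₂ : Measurable (j₂ p))
    (hj₁i : Integrable (fun z => ‖j₁ p z‖ ^ 2) μ₁)
    (hFc : Continuous fun l => F (u x) p l) (hFm : Antitone fun l => F (u x) p l)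
    {g : RE P → ℝ} (hg : Integrable g μ₁)
    (hug : ∀ z, u (x + j₁ p z) - u x - ⟪j₁ p z, p⟫_ℝ ≤ g z) :
    F (u x) p (∫ z, g z ∂μ₁ + ∫ z, (u (x + j₂ p z) - u x) ∂μ₂) ≤ f x := by
  obtain ⟨C, hC⟩ := hub
  obtain ⟨U, hUc, huU, hUC, hUlim⟩ :=
    exists_continuous_approx_of_upperSemicontinuous hC husc
  have hφd : Differentiable ℝ φ := hφ.1.differentiable (by norm_num)
  obtain ⟨K, hK⟩ := hφ.exists_remainder_le x
  rw [hp] at hK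
  have hε : ∀ n : ℕ, 0 < 1 / ((n : ℝ) + 1) := fun n => by positivity
  have hε1 : ∀ n : ℕ, 1 / ((n : ℝ) + 1) ≤ 1 := fun n => by
    rw [div_le_one (by positivity)]
    have : (0 : ℝ) ≤ n := by positivity
    linarith
  have hex : ∀ n : ℕ, ∃ ψ : RE N → ℝ, ContDiff ℝ 2 ψ ∧
      ∀ y, u y ≤ ψ y ∧ ψ y ≤ U n y + 1 / ((n : ℝ) + 1) ∧
        ψ y ≤ (φ y + (u x - φ x)) + ‖y - x‖ ^ 2 := fun n =>
    exists_contDiff_between_of_touching husc ((hUc n).add continuous_const)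
      (fun y => by linarith [huU n y, hε n]) (hφ.1.add contDiff_const)
      (fun y => by linarith [hmax y]) (by ring)
  choose ψ hψ2 hψ using hex
  have hψx : ∀ n, ψ n x = u x := fun n => by
    have h1 := (hψ n x).2.2
    have h2 := (hψ n x).1
    simp only [sub_self, norm_zero] at h1
    linarith
  have hψC : ∀ n y, |ψ n y| ≤ C + 1 := fun n y => by
    have h1 := (abs_le.1 (hC y)).1
    have h2 := hψ n y
    have h3 := hUC n y
    have h4 := hε1 n
    rw [abs_le]
    constructor <;> linarith
  have hψt : ∀ n, TestFn (ψ n) := fun n => ⟨hψ2 n, C + 1, hψC n⟩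
  have hψp : ∀ n, gradient (ψ n) x = p := fun n => by
    rw [gradient_eq_of_le_add_sq (φ := fun y => φ y + (u x - φ x))
      ((hψ2 n).differentiable (by norm_num) x) ((hφd x).add_const _)
      (by rw [hψx]; ring) (fun y => (hψ n y).2.2), gradient, fderiv_add_const, ← hp, gradient]
  have hψlim : ∀ y, Tendsto (fun n => ψ n y) atTop (𝓝 (u y)) := fun y => by
    refine tendsto_of_tendsto_of_tendsto_of_le_of_le tendsto_const_nhds ?_
      (fun n => (hψ n y).1) (fun n => (hψ n y).2.1)
    simpa using (hUlim y).add tendsto_one_div_add_atTop_nhds_zero_nat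
  set a : ℕ → RE P → ℝ := fun n z => ψ n (x + j₁ p z) - ψ n x - ⟪j₁ p z, p⟫_ℝ with ha
  set b : ℕ → RE P → ℝ := fun n z => ψ n (x + j₂ p z) - ψ n x with hb
  have ham : ∀ n, Measurable (a n) := fun n => by
    have h1 : Measurable fun z => ψ n (x + j₁ p z) :=
      (hψ2 n).continuous.measurable.comp (measurable_const.add hj₁)
    exact (h1.sub_const _).sub (hj₁.inner measurable_const)
  have hbm : ∀ n, Measurable (b n) := fun n =>
    ((hψ2 n).continuous.measurable.comp (measurable_const.add hj₂)).sub_const _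
  have haK : ∀ n z, a n z ≤ (|K| + 1) * ‖j₁ p z‖ ^ 2 := fun n z => by
    have h1 := (hψ n (x + j₁ p z)).2.2
    have h2 := (abs_le.1 (hK (j₁ p z))).2
    have h3 : K * ‖j₁ p z‖ ^ 2 ≤ |K| * ‖j₁ p z‖ ^ 2 := by gcongr; exact le_abs_self K
    rw [add_sub_cancel_left] at h1
    simp only [ha, hψx]
    linarith
  have hai : ∀ n, Integrable (a n) μ₁ := fun n => by
    obtain ⟨K', hK'⟩ := (hψt n).exists_remainder_le x
    rw [hψp] at hK'
    exact (hj₁i.const_mul K').mono' (ham n).aestronglyMeasurable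
      (Eventually.of_forall fun z => hK' _)
  have hineq : ∀ n, F (u x) p (∫ z, max (a n z) (g z) ∂μ₁ + ∫ z, b n z ∂μ₂) ≤ f x := fun n => by
    have h1 := hsub (ψ n) (hψt n) x fun y => by
      have := (hψ n y).1
      rw [hψx]
      linarith
    rw [Lop, hψp] at h1
    refine le_trans (hFm ?_) h1
    have := integral_mono (hai n) ((hai n).sup hg) fun z => le_max_left (a n z) (g z)
    exact add_le_add this le_rfl
  have hlim₁ : Tendsto (fun n => ∫ z, max (a n z) (g z) ∂μ₁) atTop (𝓝 (∫ z, g z ∂μ₁)) := by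
    refine tendsto_integral_of_dominated_convergence
      (fun z => |g z| + (|K| + 1) * ‖j₁ p z‖ ^ 2) (fun n => ((hai n).sup hg).aestronglyMeasurable)
      (hg.abs.add (hj₁i.const_mul _)) (fun n => Eventually.of_forall fun z => ?_)
      (Eventually.of_forall fun z => ?_)
    · have h1 := haK n z
      have h2 : 0 ≤ (|K| + 1) * ‖j₁ p z‖ ^ 2 := by positivity
      have h3 := le_abs_self (g z)
      have h4 := neg_abs_le (g z)
      rw [Real.norm_eq_abs, abs_le]
      exact ⟨le_trans (by linarith) (le_max_right _ _), max_le (by linarith [abs_nonneg (g z)])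
        (by linarith)⟩
    · have h1 : Tendsto (fun n => a n z) atTop
          (𝓝 (u (x + j₁ p z) - u x - ⟪j₁ p z, p⟫_ℝ)) :=
        ((hψlim _).sub (hψlim _)).sub_const _
      have h2 := h1.max (tendsto_const_nhds (x := g z))
      rwa [max_eq_right (hug z)] at h2
  have hlim₂ : Tendsto (fun n => ∫ z, b n z ∂μ₂) atTop
      (𝓝 (∫ z, (u (x + j₂ p z) - u x) ∂μ₂)) := by
    refine tendsto_integral_of_dominated_convergence (fun _ => (C + 1) + (C + 1))
      (fun n => (hbm n).aestronglyMeasurable) (integrable_const _)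
      (fun n => Eventually.of_forall fun z => ?_)
      (Eventually.of_forall fun z => (hψlim _).sub (hψlim _))
    exact (norm_sub_le _ _).trans (add_le_add (hψC _ _) (hψC _ _))
  exact le_of_tendsto' ((hFc.tendsto _).comp (hlim₁.add hlim₂)) hineq

theorem IsSuperSol.neg {N P : ℕ} {μ₁ μ₂ : Measure (RE P)}
    {j₁ j₂ : RE N → RE P → RE N} {F : ℝ → RE N → ℝ → ℝ} {f v : RE N → ℝ}
    (h : IsSuperSol μ₁ μ₂ j₁ j₂ F f v) :
    IsSubSol μ₁ μ₂ (fun p => j₁ (-p)) (fun p => j₂ (-p)) (fun r p l => -F (-r) (-p) (-l))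
      (fun x => -f x) (fun x => -v x) := by
  rintro φ ⟨hφ, C, hC⟩ x hx
  have h1 := h (fun y => -φ y) ⟨hφ.neg, C, fun y => by rw [abs_neg]; exact hC y⟩ x
    fun y => by linarith [hx y]
  have h2 : Lop μ₁ μ₂ j₁ j₂ (fun y => -φ y) x =
      -Lop μ₁ μ₂ (fun p => j₁ (-p)) (fun p => j₂ (-p)) φ x := by
    rw [Lop, Lop, neg_add, ← integral_neg, ← integral_neg, gradient_fun_neg]
    congr 2
    · ext z
      rw [inner_neg_right]
      ring
    · ext z
      ring
  rw [h2, gradient_fun_neg] at h1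
  simpa using h1

/-- The supersolution counterpart of `IsSubSol.le_of_majorant`. -/
theorem IsSuperSol.le_of_minorant {N P : ℕ} {μ₁ μ₂ : Measure (RE P)} [IsFiniteMeasure μ₂]
    {j₁ j₂ : RE N → RE P → RE N} {F : ℝ → RE N → ℝ → ℝ} {f v : RE N → ℝ}
    (hsuper : IsSuperSol μ₁ μ₂ j₁ j₂ F f v) (hvb : Bdd v) (hlsc : LowerSemicontinuous v)
    {φ : RE N → ℝ} (hφ : TestFn φ) {x p : RE N} (hp : gradient φ x = p)
    (hmin : ∀ y, v x - φ x ≤ v y - φ y)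
    (hj₁ : Measurable (j₁ p)) (hj₂ : Measurable (j₂ p))
    (hj₁i : Integrable (fun z => ‖j₁ p z‖ ^ 2) μ₁)
    (hFc : Continuous fun l => F (v x) p l) (hFm : Antitone fun l => F (v x) p l)
    {g : RE P → ℝ} (hg : Integrable g μ₁)
    (hvg : ∀ z, g z ≤ v (x + j₁ p z) - v x - ⟪j₁ p z, p⟫_ℝ) :
    f x ≤ F (v x) p (∫ z, g z ∂μ₁ + ∫ z, (v (x + j₂ p z) - v x) ∂μ₂) := by
  obtain ⟨hφ2, B, hB⟩ := hφ
  obtain ⟨C, hC⟩ := hvb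
  have husc : UpperSemicontinuous fun x => -v x := fun y c hc =>
    (hlsc y (-c) (by linarith)).mono fun y' hy' => by linarith
  have key := hsuper.neg.le_of_majorant (p := -p) (x := x) (φ := fun y => -φ y)
    (g := fun z => -g z) ⟨C, fun y => by rw [abs_neg]; exact hC y⟩ husc
    ⟨hφ2.neg, B, fun y => by rw [abs_neg]; exact hB y⟩ (by rw [gradient_fun_neg, hp])
    (fun y => by linarith [hmin y]) (by simpa using hj₁) (by simpa using hj₂)
    (by simpa using hj₁i) (by simp only [neg_neg]; exact (hFc.comp continuous_neg).neg)
    (fun l l' hl => by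
      simp only [neg_neg, neg_le_neg_iff]
      exact hFm (neg_le_neg hl))
    hg.neg (fun z => by
      simp only [neg_neg, inner_neg_right]
      linarith [hvg z])
  have h3 : ∫ z, (-v (x + j₂ p z) - -v x) ∂μ₂ = -∫ z, (v (x + j₂ p z) - v x) ∂μ₂ := by
    rw [← integral_neg]
    congr 1
    ext z
    ring
  simp only [neg_neg, integral_neg, h3, neg_add_rev] at key
  rw [add_comm]
  linarith

/-- The bounded penalty `λ‖a‖² / (1 + λ‖a‖²)`. -/
def penalty {N : ℕ} (lam : ℝ) (a : RE N) : ℝ := 1 - (1 + lam * ‖a‖ ^ 2)⁻¹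

/-- The gradient of `penalty`. -/
def penaltyGrad {N : ℕ} (lam : ℝ) (a : RE N) : RE N := (2 * lam / (1 + lam * ‖a‖ ^ 2) ^ 2) • a

section Penalty

variable {N : ℕ} {lam : ℝ}

theorem penalty_zero : penalty lam (0 : RE N) = 0 := by simp [penalty]

theorem penalty_nonneg (hl : 0 ≤ lam) (a : RE N) : 0 ≤ penalty lam a := by
  have : (1 + lam * ‖a‖ ^ 2)⁻¹ ≤ 1 := inv_le_one_of_one_le₀ (by
    have : 0 ≤ lam * ‖a‖ ^ 2 := by positivity
    linarith)
  rw [penalty]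
  linarith

theorem penalty_le_one (hl : 0 ≤ lam) (a : RE N) : penalty lam a ≤ 1 := by
  have : 0 ≤ (1 + lam * ‖a‖ ^ 2)⁻¹ := by positivity
  rw [penalty]
  linarith

theorem abs_penalty_le_one (hl : 0 ≤ lam) (a : RE N) : |penalty lam a| ≤ 1 :=
  abs_le.2 ⟨by linarith [penalty_nonneg hl a], penalty_le_one hl a⟩

theorem lt_penalty {c : ℝ} (hl : 0 ≤ lam) {a : RE N}
    (ha : c < (1 - c) * (lam * ‖a‖ ^ 2)) : c < penalty lam a := by
  have h : 0 < 1 + lam * ‖a‖ ^ 2 := by positivity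
  rw [penalty, lt_sub_comm, inv_lt_iff_one_lt_mul₀ h]
  linarith

theorem contDiff_penalty (hl : 0 ≤ lam) : ContDiff ℝ 2 (penalty lam : RE N → ℝ) := by
  have h : ∀ a : RE N, 1 + lam * ‖a‖ ^ 2 ≠ 0 := fun a => by positivity
  have h2 : ContDiff ℝ 2 fun a : RE N => 1 + lam * ‖a‖ ^ 2 :=
    contDiff_const.add (contDiff_const.mul (contDiff_norm_sq ℝ))
  exact contDiff_const.sub (h2.inv h)

theorem hasGradientAt_penalty (hl : 0 ≤ lam) (a : RE N) :
    HasGradientAt (penalty lam) (penaltyGrad lam a) a := by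
  have h : 1 + lam * ‖a‖ ^ 2 ≠ 0 := by positivity
  have h1 : HasFDerivAt (fun a : RE N => 1 + lam * ‖a‖ ^ 2)
      (lam • (2 • innerSL ℝ a)) a := by
    have := ((hasFDerivAt_id a).norm_sq.const_mul lam).const_add 1
    simpa using this
  have h2 := ((hasDerivAt_inv h).comp_hasFDerivAt a h1).const_sub 1
  rw [hasGradientAt_iff_hasFDerivAt]
  refine h2.congr_fderiv ?_
  ext y
  simp [penaltyGrad]
  ring

theorem penalty_add_le (hl : 0 ≤ lam) (a h : RE N) :
    penalty lam (a + h) ≤ penalty lam a + ⟪h, penaltyGrad lam a⟫_ℝ + lam * ‖h‖ ^ 2 := by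
  have e1 : ‖a + h‖ ^ 2 = ‖a‖ ^ 2 + 2 * ⟪a, h⟫_ℝ + ‖h‖ ^ 2 := norm_add_sq_real a h
  have e2 : ⟪h, penaltyGrad lam a⟫_ℝ = 2 * lam / (1 + lam * ‖a‖ ^ 2) ^ 2 * ⟪a, h⟫_ℝ := by
    rw [penaltyGrad, inner_smul_right, real_inner_comm]
  set s := 1 + lam * ‖a‖ ^ 2 with hs
  set t := 1 + lam * ‖a + h‖ ^ 2 with ht
  have hs1 : 1 ≤ s := by
    have : 0 ≤ lam * ‖a‖ ^ 2 := by positivity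
    linarith
  have hs0 : 0 < s := by linarith
  have ht0 : 0 < t := by positivity
  have e3 : 2 * lam / s ^ 2 * ⟪a, h⟫_ℝ = (t - s) / s ^ 2 - lam * ‖h‖ ^ 2 / s ^ 2 := by
    rw [ht, hs, e1]
    ring
  have e4 : s⁻¹ - t⁻¹ ≤ (t - s) / s ^ 2 := by
    have : (t - s) / s ^ 2 - (s⁻¹ - t⁻¹) = (t - s) ^ 2 / (s ^ 2 * t) := by
      field_simp
    have h0 : 0 ≤ (t - s) ^ 2 / (s ^ 2 * t) := by positivity
    linarith
  have e5 : lam * ‖h‖ ^ 2 / s ^ 2 ≤ lam * ‖h‖ ^ 2 :=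
    div_le_self (by positivity) (one_le_pow₀ hs1)
  rw [penalty, penalty, e2, e3, ← hs, ← ht]
  linarith

theorem norm_penaltyGrad_le (hl : 1 ≤ lam) (a : RE N) : ‖penaltyGrad lam a‖ ≤ lam := by
  have hl0 : 0 ≤ lam := by linarith
  rw [penaltyGrad, norm_smul, Real.norm_of_nonneg (by positivity), div_mul_eq_mul_div,
    div_le_iff₀ (by positivity)]
  have h1 : 2 * ‖a‖ ≤ 1 + ‖a‖ ^ 2 := by nlinarith [sq_nonneg (‖a‖ - 1)]
  have h2 : 1 + ‖a‖ ^ 2 ≤ 1 + lam * ‖a‖ ^ 2 := by nlinarith [sq_nonneg ‖a‖]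
  have h3 : 1 + lam * ‖a‖ ^ 2 ≤ (1 + lam * ‖a‖ ^ 2) ^ 2 :=
    le_self_pow₀ (by nlinarith [sq_nonneg ‖a‖]) (by norm_num)
  nlinarith [mul_le_mul_of_nonneg_left (h1.trans (h2.trans h3)) hl0]

theorem hasGradientAt_penalty_sub (hl : 0 ≤ lam) (c x : RE N) :
    HasGradientAt (fun y => penalty lam (y - c)) (penaltyGrad lam (x - c)) x := by
  have h := (hasGradientAt_penalty hl (x - c)).hasFDerivAt.comp x ((hasFDerivAt_id x).sub_const c)
  rw [hasGradientAt_iff_hasFDerivAt]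
  simpa [Function.comp_def] using h

theorem penalty_neg (a : RE N) : penalty lam (-a) = penalty lam a := by simp [penalty]

theorem penaltyGrad_neg (a : RE N) : penaltyGrad lam (-a) = -penaltyGrad lam a := by
  simp [penaltyGrad]

end Penalty

theorem integrable_sq_of_lintegral_le {N P : ℕ} {μ : Measure (RE P)} {g : RE P → RE N}
    (hg : Measurable g) {c : ℝ} (hc : 0 ≤ c)
    (h : ∫⁻ z, (‖g z‖₊ : ℝ≥0∞) ^ 2 ∂μ ≤ ENNReal.ofReal c) :
    Integrable (fun z => ‖g z‖ ^ 2) μ ∧ ∫ z, ‖g z‖ ^ 2 ∂μ ≤ c := by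
  have he : ∀ z, ENNReal.ofReal (‖g z‖ ^ 2) = (‖g z‖₊ : ℝ≥0∞) ^ 2 := fun z => by
    rw [ENNReal.ofReal_pow (norm_nonneg _), ofReal_norm, enorm_eq_nnnorm]
  have hm : AEStronglyMeasurable (fun z => ‖g z‖ ^ 2) μ :=
    (hg.norm.pow_const 2).aestronglyMeasurable
  have hnn : 0 ≤ᵐ[μ] fun z => ‖g z‖ ^ 2 := Eventually.of_forall fun z => by positivity
  constructor
  · refine ⟨hm, ?_⟩
    rw [hasFiniteIntegral_iff_ofReal hnn]
    simp only [he]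
    exact h.trans_lt ENNReal.ofReal_lt_top
  · rw [integral_eq_lintegral_of_nonneg_ae hnn hm]
    simp only [he]
    exact ENNReal.toReal_le_of_le_ofReal hc h

/-- Continuity of `p ↦ j p ∈ L²(μ)` on balls, from a modulus estimate. -/
theorem exists_delta_integral_sq_le {N P : ℕ} {μ : Measure (RE P)} {j : RE N → RE P → RE N}
    (hj : Measurable (Function.uncurry j)) {r : ℝ} {ω : ℝ → ℝ} (hω : IsModulus ω)
    (h : ∀ p q : RE N, ‖p‖ < r → ‖q‖ < r →
      ∫⁻ z, (‖j p z - j q z‖₊ : ℝ≥0∞) ^ 2 ∂μ ≤ ENNReal.ofReal (ω ‖p - q‖))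
    {τ : ℝ} (hτ : 0 < τ) :
    ∃ δ > 0, ∀ p q : RE N, ‖p‖ < r → ‖q‖ < r → ‖p - q‖ < δ →
      Integrable (fun z => ‖j p z - j q z‖ ^ 2) μ ∧ ∫ z, ‖j p z - j q z‖ ^ 2 ∂μ ≤ τ := by
  obtain ⟨δ, hδ, hδω⟩ := (mem_nhdsGT_iff_exists_Ioo_subset).1
    (hω.2.2.eventually (gt_mem_nhds hτ))
  refine ⟨δ, hδ, fun p q hp hq hpq => ?_⟩
  rcases eq_or_ne p q with rfl | hne
  · simpa using hτ.le
  · have hm : Measurable fun z => j p z - j q z :=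
      (hj.comp measurable_prodMk_left).sub (hj.comp measurable_prodMk_left)
    obtain ⟨h1, h2⟩ := integrable_sq_of_lintegral_le hm (hω.1 _) (h p q hp hq)
    have : ω ‖p - q‖ < τ := hδω ⟨norm_pos_iff.2 (sub_ne_zero.2 hne), hpq⟩
    exact ⟨h1, h2.trans this.le⟩

/-- For a finite measure, truncated jump differences are small in mean, uniformly on balls. -/
theorem exists_delta_integral_min_lt {N P : ℕ} {μ : Measure (RE P)} [IsFiniteMeasure μ]
    {j : RE N → RE P → RE N} (hj : Measurable (Function.uncurry j))
    (hjc : ∀ᵐ z ∂μ, Continuous fun p => j p z) {A L : ℝ} (hA : 0 ≤ A) (hL : 0 ≤ L) (r : ℝ)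
    {τ : ℝ} (hτ : 0 < τ) :
    ∃ δ > 0, ∀ p q : RE N, ‖p‖ ≤ r → ‖q‖ ≤ r → ‖p - q‖ < δ →
      ∫ z, min A (L * (‖j p z - j q z‖ + ‖j p z - j q z‖ ^ 2)) ∂μ < τ := by
  set E : RE N × RE N → ℝ := fun t =>
    ∫ z, min A (L * (‖j t.1 z - j t.2 z‖ + ‖j t.1 z - j t.2 z‖ ^ 2)) ∂μ with hE
  have hEc : Continuous E := by
    refine continuous_of_dominated (bound := fun _ => A) (fun t => ?_)
      (fun t => Eventually.of_forall fun z => ?_) (integrable_const _) ?_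
    · have h1 : Measurable (j t.1) := hj.comp measurable_prodMk_left
      have h2 : Measurable (j t.2) := hj.comp measurable_prodMk_left
      have h3 := (h1.sub h2).norm
      exact (measurable_const.min ((h3.add (h3.pow_const 2)).const_mul L)).aestronglyMeasurable
    · rw [Real.norm_of_nonneg (le_min hA (by positivity))]
      exact min_le_left _ _
    · filter_upwards [hjc] with z hz
      have h1 : Continuous fun t : RE N × RE N => j t.1 z := hz.comp continuous_fst
      have h2 : Continuous fun t : RE N × RE N => j t.2 z := hz.comp continuous_snd
      fun_prop
  have huc := ((isCompact_closedBall (0 : RE N) r).prod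
    (isCompact_closedBall (0 : RE N) r)).uniformContinuousOn_of_continuous hEc.continuousOn
  obtain ⟨δ, hδ, h⟩ := Metric.uniformContinuousOn_iff.1 huc τ hτ
  refine ⟨δ, hδ, fun p q hp hq hpq => ?_⟩
  have hp' : p ∈ closedBall (0 : RE N) r := by simpa using hp
  have hq' : q ∈ closedBall (0 : RE N) r := by simpa using hq
  have h1 := h (p, q) ⟨hp', hq'⟩ (q, q) ⟨hq', hq'⟩ (by
    rw [Prod.dist_eq, dist_self, dist_eq_norm]
    exact max_lt hpq hδ)
  have h0 : E (q, q) = 0 := by simp [hE, hA]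
  rw [h0, Real.dist_eq, sub_zero] at h1
  exact (abs_lt.1 h1).2

/-- Existence of a maximum in the doubling of variables, after a small localizing perturbation. -/
theorem exists_max_doubling {N : ℕ} {u v : RE N → ℝ} {C A lam η m : ℝ}
    (husc : UpperSemicontinuous u) (hlsc : LowerSemicontinuous v)
    (hu : ∀ x, |u x| ≤ C) (hv : ∀ x, |v x| ≤ C) (hA : 4 * C ≤ A) (hl : 1 ≤ lam)
    (hη : 0 < η) (hηm : η < m) {x₁ : RE N} (hx₁ : m ≤ u x₁ - v x₁) :
    ∃ x₀ x y : RE N, (∀ x' y', u x' - v y' - A * penalty lam (x' - y')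
        - 2 * η * penalty 1 (x' - x₀) ≤
      u x - v y - A * penalty lam (x - y) - 2 * η * penalty 1 (x - x₀)) ∧
      lam * ‖x - y‖ ^ 2 ≤ 1 ∧ m - η ≤ u x - v y := by
  have hl0 : 0 ≤ lam := by linarith
  have hC : 0 ≤ C := (abs_nonneg _).trans (hu x₁)
  have hA0 : 0 ≤ A := by linarith
  set w : RE N × RE N → ℝ := fun t => u t.1 - v t.2 - A * penalty lam (t.1 - t.2) with hw
  have hwC : ∀ t, w t ≤ 2 * C := fun t => by
    have h1 := (abs_le.1 (hu t.1)).2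
    have h2 := (abs_le.1 (hv t.2)).1
    have h3 := mul_nonneg hA0 (penalty_nonneg hl0 (t.1 - t.2))
    simp only [hw]
    linarith
  have hwfar : ∀ t : RE N × RE N, 1 < lam * ‖t.1 - t.2‖ ^ 2 → w t ≤ 0 := fun t ht => by
    have h1 := (abs_le.1 (hu t.1)).2
    have h2 := (abs_le.1 (hv t.2)).1
    have h3 : 1 / 2 < penalty lam (t.1 - t.2) := lt_penalty hl0 (by linarith)
    have h4 := mul_le_mul_of_nonneg_left h3.le hA0
    simp only [hw]
    linarith
  have hbdd : BddAbove (Set.range w) := ⟨2 * C, by rintro _ ⟨t, rfl⟩; exact hwC t⟩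
  have hmS : m ≤ sSup (Set.range w) := by
    refine le_trans ?_ (le_csSup hbdd ⟨(x₁, x₁), rfl⟩)
    simpa [hw, penalty_zero] using hx₁
  obtain ⟨_, ⟨⟨x₀, y₀⟩, rfl⟩, h₀⟩ := exists_lt_of_lt_csSup (Set.range_nonempty w)
    (by linarith : sSup (Set.range w) - η < sSup (Set.range w))
  set G : RE N × RE N → ℝ := fun t => w t - 2 * η * penalty 1 (t.1 - x₀) with hG
  have hG₀ : G (x₀, y₀) = w (x₀, y₀) := by simp [hG, penalty_zero]
  set K : Set (RE N × RE N) := {t | ‖t.1 - x₀‖ ≤ 1 ∧ lam * ‖t.1 - t.2‖ ^ 2 ≤ 1} with hK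
  have hKfar : ∀ t ∉ K, G t < G (x₀, y₀) := fun t ht => by
    have hp1 := penalty_nonneg zero_le_one (t.1 - x₀)
    rcases lt_or_ge 1 (‖t.1 - x₀‖) with h | h
    · have h3 : 1 / 2 < penalty 1 (t.1 - x₀) := lt_penalty zero_le_one (by nlinarith)
      have h4 : w t ≤ sSup (Set.range w) := le_csSup hbdd ⟨t, rfl⟩
      rw [hG₀]
      simp only [hG]
      nlinarith
    · have h3 := hwfar t (by
        by_contra h'
        exact ht ⟨h, not_lt.1 h'⟩)
      rw [hG₀]
      simp only [hG]
      nlinarith [mul_nonneg hη.le hp1]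
  have hmem : (x₀, y₀) ∈ K := by
    by_contra h
    have h' := hwfar (x₀, y₀) (by
      by_contra h'
      exact h ⟨by simp, not_lt.1 h'⟩)
    linarith
  have hKc : IsCompact K := by
    refine ((isCompact_closedBall x₀ 2).prod (isCompact_closedBall x₀ 2)).of_isClosed_subset
      ?_ fun t ht => ?_
    · have c1 : Continuous fun t : RE N × RE N => ‖t.1 - x₀‖ := by fun_prop
      have c2 : Continuous fun t : RE N × RE N => lam * ‖t.1 - t.2‖ ^ 2 := by fun_prop
      exact (isClosed_le c1 continuous_const).inter (isClosed_le c2 continuous_const)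
    · have h1 := ht.1
      have h2 : ‖t.1 - t.2‖ ≤ 1 := by
        have := ht.2
        by_contra h
        push Not at h
        nlinarith
      have h3 : ‖t.2 - x₀‖ ≤ ‖t.1 - t.2‖ + ‖t.1 - x₀‖ := by
        rw [norm_sub_rev t.1 t.2]
        exact norm_sub_le_norm_sub_add_norm_sub _ _ _
      simp only [Set.mem_prod, mem_closedBall, dist_eq_norm]
      constructor <;> linarith
  have hGusc : UpperSemicontinuous G := by
    have h1 : UpperSemicontinuous fun t : RE N × RE N => u t.1 := husc.comp continuous_fst
    have h2 : UpperSemicontinuous fun t : RE N × RE N => -v t.2 := fun t c hc =>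
      ((hlsc.comp continuous_snd) t (-c) (by linarith : -c < v t.2)).mono
        fun t' ht' => neg_lt.1 ht'
    have h3 : Continuous fun t : RE N × RE N =>
        -(A * penalty lam (t.1 - t.2)) - 2 * η * penalty 1 (t.1 - x₀) := by
      have c1 := (contDiff_penalty (N := N) hl0).continuous
      have c2 := (contDiff_penalty (N := N) zero_le_one).continuous
      fun_prop
    have h4 := (h1.add h2).add h3.upperSemicontinuous
    have h5 : G = fun t => u t.1 + -v t.2 +
        (-(A * penalty lam (t.1 - t.2)) - 2 * η * penalty 1 (t.1 - x₀)) := by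
      ext t
      simp only [hG, hw]
      ring
    rw [h5]
    exact h4
  obtain ⟨⟨x, y⟩, hxyK, hxy⟩ :=
    (hGusc.upperSemicontinuousOn K).exists_isMaxOn ⟨_, hmem⟩ hKc
  have hmax : ∀ t, G t ≤ G (x, y) := fun t => by
    by_cases ht : t ∈ K
    · exact hxy ht
    · exact (hKfar t ht).le.trans (hxy hmem)
  refine ⟨x₀, x, y, fun x' y' => hmax (x', y'), hxyK.2, ?_⟩
  have h1 := hmax (x₀, y₀)
  rw [hG₀] at h1
  have h2 := mul_nonneg hA0 (penalty_nonneg hl0 (x - y))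
  have h3 := mul_nonneg hη.le (penalty_nonneg zero_le_one (x - x₀))
  simp only [hG, hw] at h1 h₀
  linarith

section Doubling

variable {N : ℕ} {u v : RE N → ℝ} {A lam η : ℝ} {x₀ x y p q : RE N}

/-- Nonlocal maximum principle for the doubled problem: compensated increments. -/
theorem compensated_increment_le (hA : 0 ≤ A) (hl : 0 ≤ lam) (hη : 0 ≤ η)
    (hmax : ∀ x' y', u x' - v y' - A * penalty lam (x' - y') - 2 * η * penalty 1 (x' - x₀) ≤
      u x - v y - A * penalty lam (x - y) - 2 * η * penalty 1 (x - x₀))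
    (hp : p = A • penaltyGrad lam (x - y))
    (hq : q = p + (2 * η) • penaltyGrad 1 (x - x₀)) (h k : RE N) :
    u (x + h) - u x - ⟪h, q⟫_ℝ ≤
      v (y + k) - v y - ⟪k, p⟫_ℝ + A * lam * ‖h - k‖ ^ 2 + 2 * η * ‖h‖ ^ 2 := by
  have h1 := hmax (x + h) (y + k)
  have e1 : x + h - (y + k) = x - y + (h - k) := by abel
  have e2 : x + h - x₀ = x - x₀ + h := by abel
  rw [e1, e2] at h1
  have h2 := mul_le_mul_of_nonneg_left (penalty_add_le hl (x - y) (h - k)) hA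
  have h3 := mul_le_mul_of_nonneg_left (penalty_add_le zero_le_one (x - x₀) h)
    (by positivity : 0 ≤ 2 * η)
  have e3 : ⟪h, q⟫_ℝ = ⟪h, p⟫_ℝ + 2 * η * ⟪h, penaltyGrad 1 (x - x₀)⟫_ℝ := by
    rw [hq, inner_add_right, inner_smul_right]
  have e4 : ⟪h, p⟫_ℝ - ⟪k, p⟫_ℝ = A * ⟪h - k, penaltyGrad lam (x - y)⟫_ℝ := by
    rw [← inner_sub_left, hp, inner_smul_right]
  rw [e3]
  linarith

/-- Nonlocal maximum principle for the doubled problem: plain increments. -/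
theorem increment_sub_le (hA : 0 ≤ A) (hl : 1 ≤ lam) (hη : 0 ≤ η)
    (hmax : ∀ x' y', u x' - v y' - A * penalty lam (x' - y') - 2 * η * penalty 1 (x' - x₀) ≤
      u x - v y - A * penalty lam (x - y) - 2 * η * penalty 1 (x - x₀)) (h k : RE N) :
    u (x + h) - u x - (v (y + k) - v y) ≤
      min A (A * lam * (‖h - k‖ + ‖h - k‖ ^ 2)) + 2 * η := by
  have hl0 : 0 ≤ lam := by linarith
  have h1 := hmax (x + h) (y + k)
  have e1 : x + h - (y + k) = x - y + (h - k) := by abel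
  rw [e1] at h1
  have h2 : 2 * η * penalty 1 (x + h - x₀) - 2 * η * penalty 1 (x - x₀) ≤ 2 * η := by
    nlinarith [mul_nonneg hη (penalty_nonneg zero_le_one (x - x₀)),
      mul_le_mul_of_nonneg_left (penalty_le_one zero_le_one (x + h - x₀)) hη]
  have h3 : A * penalty lam (x - y + (h - k)) - A * penalty lam (x - y) ≤
      min A (A * lam * (‖h - k‖ + ‖h - k‖ ^ 2)) := by
    refine le_min ?_ ?_
    · nlinarith [mul_nonneg hA (penalty_nonneg hl0 (x - y)),
        mul_le_mul_of_nonneg_left (penalty_le_one hl0 (x - y + (h - k))) hA]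
    · have h4 := penalty_add_le hl0 (x - y) (h - k)
      have h5 := real_inner_le_norm (h - k) (penaltyGrad lam (x - y))
      have h6 := mul_le_mul_of_nonneg_left (norm_penaltyGrad_le hl (x - y)) (norm_nonneg (h - k))
      have h7 := mul_le_mul_of_nonneg_left
        (by linarith : penalty lam (x - y + (h - k)) - penalty lam (x - y) ≤
          lam * (‖h - k‖ + ‖h - k‖ ^ 2)) hA
      linarith
  linarith [penalty_nonneg zero_le_one (x + h - x₀)]

end Doubling

/-- Value of `F` at a maximum of the doubled problem: both viscosity inequalities hold with
nonlocal terms `l₁`, `l₂` which are ordered up to an explicit error. -/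
theorem exists_levels_of_doubling {N P : ℕ} {μ₁ μ₂ : Measure (RE P)} [IsFiniteMeasure μ₂]
    {j₁ j₂ : RE N → RE P → RE N} {F : ℝ → RE N → ℝ → ℝ} {f u v : RE N → ℝ}
    (hj₁ : ∀ p, Measurable (j₁ p)) (hj₂ : ∀ p, Measurable (j₂ p))
    (hFc : ∀ r p, Continuous fun l => F r p l) (hFm : ∀ r p, Antitone fun l => F r p l)
    {C : ℝ} (hu : ∀ x, |u x| ≤ C) (hv : ∀ x, |v x| ≤ C)
    (husc : UpperSemicontinuous u) (hlsc : LowerSemicontinuous v)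
    (hsub : IsSubSol μ₁ μ₂ j₁ j₂ F f u) (hsuper : IsSuperSol μ₁ μ₂ j₁ j₂ F f v)
    {A lam η : ℝ} (hA : 0 ≤ A) (hl : 1 ≤ lam) (hη : 0 < η) {x₀ x y p q : RE N}
    (hmax : ∀ x' y', u x' - v y' - A * penalty lam (x' - y') - 2 * η * penalty 1 (x' - x₀) ≤
      u x - v y - A * penalty lam (x - y) - 2 * η * penalty 1 (x - x₀))
    (hp : p = A • penaltyGrad lam (x - y))
    (hq : q = p + (2 * η) • penaltyGrad 1 (x - x₀))
    (hqi : Integrable (fun z => ‖j₁ q z‖ ^ 2) μ₁) (hpi : Integrable (fun z => ‖j₁ p z‖ ^ 2) μ₁)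
    (hqpi : Integrable (fun z => ‖j₁ q z - j₁ p z‖ ^ 2) μ₁) :
    ∃ l₁ l₂ : ℝ, F (u x) q l₁ ≤ f x ∧ f y ≤ F (v y) p l₂ ∧
      l₁ - l₂ ≤ A * lam * ∫ z, ‖j₁ q z - j₁ p z‖ ^ 2 ∂μ₁ + 2 * η * ∫ z, ‖j₁ q z‖ ^ 2 ∂μ₁ +
        ∫ z, min A (A * lam * (‖j₂ q z - j₂ p z‖ + ‖j₂ q z - j₂ p z‖ ^ 2)) ∂μ₂ +
        2 * η * μ₂.real Set.univ ∧
      |l₁| ≤ (A * lam + 2 * η) * (∫ z, ‖j₁ q z‖ ^ 2 ∂μ₁ + ∫ z, ‖j₁ p z‖ ^ 2 ∂μ₁) +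
        2 * C * μ₂.real Set.univ := by
  have hl0 : 0 ≤ lam := by linarith
  have hinc := compensated_increment_le hA hl0 hη.le hmax hp hq
  set a : RE P → ℝ := fun z => u (x + j₁ q z) - u x - ⟪j₁ q z, q⟫_ℝ with ha
  set g : RE P → ℝ := fun z => max (a z) (-(A * lam) * ‖j₁ p z‖ ^ 2) with hg
  set err : RE P → ℝ := fun z => A * lam * ‖j₁ q z - j₁ p z‖ ^ 2 + 2 * η * ‖j₁ q z‖ ^ 2 with herr
  have hAl : 0 ≤ A * lam := by positivity
  have ha_le : ∀ z, a z ≤ (A * lam + 2 * η) * ‖j₁ q z‖ ^ 2 := fun z => by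
    have := hinc (j₁ q z) 0
    simp only [add_zero, sub_self, inner_zero_left, sub_zero] at this
    simp only [ha]
    linarith
  have hg_abs : ∀ z, |g z| ≤ (A * lam + 2 * η) * (‖j₁ q z‖ ^ 2 + ‖j₁ p z‖ ^ 2) := fun z => by
    have h1 := ha_le z
    have h2 : 0 ≤ (A * lam + 2 * η) * ‖j₁ q z‖ ^ 2 := by positivity
    have h3 : 0 ≤ A * lam * ‖j₁ p z‖ ^ 2 := by positivity
    have h4 : 0 ≤ 2 * η * ‖j₁ p z‖ ^ 2 := by positivity
    rw [abs_le]
    exact ⟨le_trans (by linarith) (le_max_right _ _), max_le (by linarith) (by linarith)⟩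
  have ham : Measurable a :=
    ((husc.measurable.comp (measurable_const.add (hj₁ q))).sub_const _).sub
      ((hj₁ q).inner measurable_const)
  have hbd := (hqi.add hpi).const_mul (A * lam + 2 * η)
  have hgi : Integrable g μ₁ :=
    hbd.mono' (ham.max (((hj₁ p).norm.pow_const 2).const_mul _)).aestronglyMeasurable
      (Eventually.of_forall hg_abs)
  have herri : Integrable err μ₁ := (hqpi.const_mul _).add (hqi.const_mul _)
  have hv_ge : ∀ z, g z - err z ≤ v (y + j₁ p z) - v y - ⟪j₁ p z, p⟫_ℝ := fun z => by
    have h1 := hinc (j₁ q z) (j₁ p z)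
    have h2 := hinc 0 (j₁ p z)
    simp only [add_zero, sub_self, inner_zero_left, zero_sub, norm_neg, norm_zero] at h2
    have h3 : 0 ≤ err z := by simp only [herr]; positivity
    rw [sub_le_iff_le_add]
    refine max_le ?_ ?_
    · simp only [ha, herr]
      linarith
    · linarith
  set b : RE P → ℝ := fun z => u (x + j₂ q z) - u x with hb
  set c : RE P → ℝ := fun z => v (y + j₂ p z) - v y with hc
  set d : RE P → ℝ := fun z =>
    min A (A * lam * (‖j₂ q z - j₂ p z‖ + ‖j₂ q z - j₂ p z‖ ^ 2)) with hd
  have hb_abs : ∀ z, ‖b z‖ ≤ 2 * C := fun z =>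
    (norm_sub_le _ _).trans ((add_le_add (hu _) (hu _)).trans_eq (by ring))
  have hbi : Integrable b μ₂ := .of_bound
    ((husc.measurable.comp (measurable_const.add (hj₂ q))).sub_const _).aestronglyMeasurable
    (2 * C) (Eventually.of_forall hb_abs)
  have hci : Integrable c μ₂ := .of_bound
    ((hlsc.measurable.comp (measurable_const.add (hj₂ p))).sub_const _).aestronglyMeasurable
    (2 * C) (Eventually.of_forall fun z =>
      (norm_sub_le _ _).trans ((add_le_add (hv _) (hv _)).trans_eq (by ring)))
  have hdi : Integrable d μ₂ := by
    have h3 := ((hj₂ q).sub (hj₂ p)).norm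
    refine .of_bound
      (measurable_const.min ((h3.add (h3.pow_const 2)).const_mul _)).aestronglyMeasurable A
      (Eventually.of_forall fun z => ?_)
    rw [Real.norm_of_nonneg (le_min hA (by positivity))]
    exact min_le_left _ _
  have hbcd : ∫ z, b z ∂μ₂ - ∫ z, c z ∂μ₂ ≤ ∫ z, d z ∂μ₂ + 2 * η * μ₂.real Set.univ := by
    have h1 : ∫ z, (b z - c z) ∂μ₂ ≤ ∫ z, (d z + 2 * η) ∂μ₂ :=
      integral_mono (hbi.sub hci) (hdi.add (integrable_const (2 * η)))
        fun z => increment_sub_le hA hl hη.le hmax (j₂ q z) (j₂ p z)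
    rw [integral_sub hbi hci, integral_add hdi (integrable_const _), integral_const, smul_eq_mul,
      mul_comm (μ₂.real _)] at h1
    exact h1
  have hgrad₁ : HasGradientAt
      (fun t => A * penalty lam (t - y) + 2 * η * penalty 1 (t - x₀)) q x := by
    have h1 := (hasGradientAt_penalty_sub hl0 y x).hasFDerivAt.const_mul A
    have h2 := (hasGradientAt_penalty_sub zero_le_one x₀ x).hasFDerivAt.const_mul (2 * η)
    rw [hasGradientAt_iff_hasFDerivAt, hq, hp, map_add, map_smul, map_smul]
    exact h1.add h2
  have hgrad₂ : HasGradientAt (fun t => -A * penalty lam (t - x)) p y := by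
    have h1 := (hasGradientAt_penalty_sub hl0 x y).hasFDerivAt.const_mul (-A)
    have hp' : p = (-A) • penaltyGrad lam (y - x) := by
      rw [hp, ← neg_sub y x, penaltyGrad_neg, smul_neg, neg_smul]
    rw [hasGradientAt_iff_hasFDerivAt, hp', map_smul]
    exact h1
  have hs : ∀ (L : ℝ) (w : RE N), 0 ≤ L → ContDiff ℝ 2 fun t : RE N => penalty L (t - w) :=
    fun L w hL => (contDiff_penalty hL).comp (contDiff_id.sub contDiff_const)
  have htest₁ : TestFn fun t => A * penalty lam (t - y) + 2 * η * penalty 1 (t - x₀) := by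
    refine ⟨(contDiff_const.mul (hs _ _ hl0)).add (contDiff_const.mul (hs _ _ zero_le_one)),
      A + 2 * η, fun t => (abs_add_le _ _).trans (add_le_add ?_ ?_)⟩
    · rw [abs_mul, abs_of_nonneg hA]
      exact mul_le_of_le_one_right hA (abs_penalty_le_one hl0 _)
    · rw [abs_mul, abs_of_nonneg (by positivity : 0 ≤ 2 * η)]
      exact mul_le_of_le_one_right (by positivity) (abs_penalty_le_one zero_le_one _)
  have htest₂ : TestFn fun t => -A * penalty lam (t - x) := by
    refine ⟨contDiff_const.mul (hs _ _ hl0), A, fun t => ?_⟩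
    rw [abs_mul, abs_neg, abs_of_nonneg hA]
    exact mul_le_of_le_one_right hA (abs_penalty_le_one hl0 _)
  refine ⟨∫ z, g z ∂μ₁ + ∫ z, b z ∂μ₂, ∫ z, (g z - err z) ∂μ₁ + ∫ z, c z ∂μ₂, ?_, ?_, ?_, ?_⟩
  · exact hsub.le_of_majorant ⟨C, hu⟩ husc htest₁ hgrad₁.gradient
      (fun t => by linarith [hmax t y]) (hj₁ q) (hj₂ q) hqi (hFc _ _) (hFm _ _) hgi
      fun z => le_max_left _ _
  · refine hsuper.le_of_minorant ⟨C, hv⟩ hlsc htest₂ hgrad₂.gradient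
      (fun t => ?_) (hj₁ p) (hj₂ p) hpi (hFc _ _) (hFm _ _) (hgi.sub herri) hv_ge
    have := hmax x t
    rw [← neg_sub t x, ← neg_sub y x, penalty_neg, penalty_neg] at this
    linarith
  · have h1 : ∫ z, err z ∂μ₁ =
        A * lam * ∫ z, ‖j₁ q z - j₁ p z‖ ^ 2 ∂μ₁ + 2 * η * ∫ z, ‖j₁ q z‖ ^ 2 ∂μ₁ := by
      rw [integral_add (hqpi.const_mul _) (hqi.const_mul _), integral_const_mul,
        integral_const_mul]
    rw [integral_sub hgi herri]
    linarith
  · have h1 : |∫ z, g z ∂μ₁| ≤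
        (A * lam + 2 * η) * (∫ z, ‖j₁ q z‖ ^ 2 ∂μ₁ + ∫ z, ‖j₁ p z‖ ^ 2 ∂μ₁) := by
      have h3 := norm_integral_le_of_norm_le (f := g) hbd (Eventually.of_forall hg_abs)
      rw [integral_const_mul] at h3
      exact h3.trans_eq (congrArg _ (integral_add hqi hpi))
    have h2 : |∫ z, b z ∂μ₂| ≤ 2 * C * μ₂.real Set.univ :=
      norm_integral_le_of_norm_le_const (Eventually.of_forall hb_abs)
    exact (abs_add_le _ _).trans (add_le_add h1 h2)

set_option maxHeartbeats 1600000 in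
/-- Comparison principle for the fully nonlinear nonlocal equation
`F(u, Du, L[u,Du]) = f` in `ℝ^N`. -/
theorem comparison_fully_nonlinear
    (N P : ℕ) (hN : 1 ≤ N) (hP : 1 ≤ P)
    (μ₁ μ₂ : Measure (RE P)) (j₁ j₂ : RE N → RE P → RE N)
    (F : ℝ → RE N → ℝ → ℝ) (f u v : RE N → ℝ)
    -- (M)
    (hM0 : μ₁ {0} = 0) (hM0' : μ₂ {0} = 0)
    (hM1 : (∫⁻ z, (‖z‖₊ : ℝ≥0∞) ^ 2 ∂μ₁) < ⊤)
    (hM2 : μ₂ Set.univ < ⊤)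
    -- j measurable and continuous in p for a.e. z
    (hj₁m : Measurable (Function.uncurry j₁))
    (hj₂m : Measurable (Function.uncurry j₂))
    (hj₁c : ∀ᵐ z ∂μ₁, Continuous fun p => j₁ p z)
    (hj₂c : ∀ᵐ z ∂μ₂, Continuous fun p => j₂ p z)
    -- (J1)
    (hJ1 : ∀ r > 0, ∃ C > 0, ∀ p : RE N, ‖p‖ < r →
      (∫⁻ z, (‖j₁ p z‖₊ : ℝ≥0∞) ^ 2 ∂μ₁) ≤ ENNReal.ofReal C)
    -- (J2)
    (hJ2 : ∀ r > 0, ∃ ω : ℝ → ℝ, IsModulus ω ∧ ∀ p q : RE N, ‖p‖ < r → ‖q‖ < r →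
      (∫⁻ z, (‖j₁ p z - j₁ q z‖₊ : ℝ≥0∞) ^ 2 ∂μ₁) ≤ ENNReal.ofReal (ω ‖p - q‖))
    -- (F1)
    (hF1c : Continuous fun t : ℝ × RE N × ℝ => F t.1 t.2.1 t.2.2)
    (hF1m : ∀ (r : ℝ) (p : RE N) (l l' : ℝ), l ≤ l' → F r p l' ≤ F r p l)
    -- (F2)
    (hF2 : ∀ M > 0, ∃ γ > 0, ∀ (a b : ℝ) (p : RE N) (l : ℝ),
      -M ≤ b → b ≤ a → a ≤ M → γ * (a - b) ≤ F a p l - F b p l)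
    -- (F3)
    (hF3 : ∀ M > 0, ∀ r > 0, ∃ ω : ℝ → ℝ, IsModulus ω ∧
      ∀ (a : ℝ) (p q : RE N) (l l' : ℝ), |a| ≤ M → ‖p‖ ≤ r → ‖q‖ ≤ r → |l| ≤ r → |l'| ≤ r →
        |F a p l - F a q l'| ≤ ω (‖p - q‖ + |l - l'|))
    -- (F4)
    (hf : UniformContinuous f)
    -- u : bounded usc viscosity subsolution, v : bounded lsc viscosity supersolution
    (hub : Bdd u) (husc : UpperSemicontinuous u)
    (hsub : IsSubSol μ₁ μ₂ j₁ j₂ F f u)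
    (hvb : Bdd v) (hlsc : LowerSemicontinuous v)
    (hsuper : IsSuperSol μ₁ μ₂ j₁ j₂ F f v) :
    ∀ x, u x ≤ v x := by
  intro x₁
  by_contra! hx₁
  obtain ⟨Cu, hCu⟩ := hub
  obtain ⟨Cv, hCv⟩ := hvb
  have : IsFiniteMeasure μ₂ := ⟨hM2⟩
  set C := max (max Cu Cv) 1 with hC
  have hu : ∀ x, |u x| ≤ C := fun x =>
    (hCu x).trans ((le_max_left _ _).trans (le_max_left _ _))
  have hv : ∀ x, |v x| ≤ C := fun x =>
    (hCv x).trans ((le_max_right _ _).trans (le_max_left _ _))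
  have hC1 : 1 ≤ C := le_max_right _ _
  set m := u x₁ - v x₁ with hm
  have hm0 : 0 < m := sub_pos.2 hx₁
  obtain ⟨γ, hγ, hFγ⟩ := hF2 C (by linarith)
  have hγm : 0 < γ * m / 8 := by positivity
  obtain ⟨δf, hδf, hfδ⟩ := Metric.uniformContinuous_iff.1 hf _ hγm
  set lam := 1 + 1 / δf ^ 2 with hlam
  have hinv : 0 < 1 / δf ^ 2 := by positivity
  have hl : 1 ≤ lam := by linarith
  have hclose : ∀ a : RE N, lam * ‖a‖ ^ 2 ≤ 1 → ‖a‖ < δf := fun a ha => by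
    by_contra! h
    have h1 : δf ^ 2 ≤ ‖a‖ ^ 2 := by gcongr
    have h2 : lam * δf ^ 2 = δf ^ 2 + 1 := by
      rw [hlam]
      field_simp
    have h3 : lam * δf ^ 2 ≤ lam * ‖a‖ ^ 2 := mul_le_mul_of_nonneg_left h1 (by linarith)
    have h4 : 0 < δf ^ 2 := by positivity
    linarith
  set A := 4 * C with hA
  have hA0 : 0 ≤ A := by linarith
  set L := A * lam with hL
  have hL0 : 0 ≤ L := by positivity
  obtain ⟨CJ, hCJ, hJ⟩ := hJ1 (L + 2) (by linarith)
  obtain ⟨ωj, hωj, hJω⟩ := hJ2 (L + 2) (by linarith)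
  have hj₁p : ∀ p, Measurable (j₁ p) := fun p => hj₁m.comp measurable_prodMk_left
  have hj₂p : ∀ p, Measurable (j₂ p) := fun p => hj₂m.comp measurable_prodMk_left
  set V := μ₂.real Set.univ with hV
  have hV0 : 0 ≤ V := measureReal_nonneg
  set r := (L + 2) + ((L + 2) * (CJ + CJ) + 2 * C * V + 1) with hr
  have hr1 : 0 ≤ (L + 2) * (CJ + CJ) := by positivity
  have hr2 : 0 ≤ 2 * C * V := by positivity
  obtain ⟨ωF, hωF, hFω⟩ := hF3 C (by linarith) r (by linarith)
  obtain ⟨t₀, ht₀, hωt⟩ := (mem_nhdsGT_iff_exists_Ioo_subset).1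
    (hωF.2.2.eventually (gt_mem_nhds hγm))
  rw [Set.mem_Ioi] at ht₀
  set s := min 1 (t₀ / 2) with hs
  have hs0 : 0 < s := lt_min one_pos (by linarith)
  have hs1 : s ≤ 1 := min_le_left _ _
  have hst : s ≤ t₀ / 2 := min_le_right _ _
  obtain ⟨δ₁, hδ₁, hjδ₁⟩ := exists_delta_integral_sq_le hj₁m hωj hJω
    (by positivity : 0 < s / (4 * (L + 1)))
  obtain ⟨δ₂, hδ₂, hjδ₂⟩ := exists_delta_integral_min_lt hj₂m hj₂c hA0 hL0 (L + 2)
    (by positivity : 0 < s / 4)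
  have hev : ∀ c : ℝ, 0 < c → ∀ᶠ η in 𝓝[>] (0 : ℝ), η < c := fun c hc =>
    (eventually_lt_nhds hc).filter_mono nhdsWithin_le_nhds
  obtain ⟨η, hη1, hη2, hη3, hη4, hη5, hη6, hη7, hη⟩ :=
    ((hev (m / 2) (by positivity)).and <| (hev (1 / 2) (by positivity)).and <|
      (hev (t₀ / 8) (by positivity)).and <| (hev (δ₁ / 4) (by positivity)).and <|
      (hev (δ₂ / 4) (by positivity)).and <| (hev (s / (8 * CJ)) (by positivity)).and <|
      (hev (s / (8 * (V + 1))) (by positivity)).and <| self_mem_nhdsWithin).exists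
  obtain ⟨x₀, x, y, hmax, hxy, hmuv⟩ := exists_max_doubling husc hlsc hu hv hA.ge hl hη
    (by linarith : η < m) le_rfl
  set p := A • penaltyGrad lam (x - y) with hp
  set q := p + (2 * η) • penaltyGrad 1 (x - x₀) with hq
  have hpL : ‖p‖ ≤ L := by
    rw [hp, norm_smul, Real.norm_of_nonneg hA0]
    exact mul_le_mul_of_nonneg_left (norm_penaltyGrad_le hl _) hA0
  have hqp : ‖q - p‖ ≤ 2 * η := by
    rw [hq, add_sub_cancel_left, norm_smul, Real.norm_of_nonneg (by positivity)]
    exact mul_le_of_le_one_right (by positivity) (norm_penaltyGrad_le le_rfl _)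
  have hqL : ‖q‖ ≤ L + 1 := by
    have := norm_add_le p (q - p)
    rw [add_sub_cancel] at this
    linarith
  obtain ⟨hqi, hqC⟩ := integrable_sq_of_lintegral_le (hj₁p q) hCJ.le (hJ q (by linarith))
  obtain ⟨hpi, hpC⟩ := integrable_sq_of_lintegral_le (hj₁p p) hCJ.le (hJ p (by linarith))
  obtain ⟨hqpi, hqpC⟩ := hjδ₁ q p (by linarith) (by linarith) (by linarith)
  have hdC := hjδ₂ q p (by linarith) (by linarith) (by linarith)
  obtain ⟨l₁, l₂, hsubl, hsuperl, hll, hl₁⟩ := exists_levels_of_doubling (F := F) hj₁p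
    hj₂p
    (fun a p => hF1c.comp (by fun_prop : Continuous fun l : ℝ => (a, p, l)))
    (fun a p l l' h => hF1m a p l l' h) hu hv husc hlsc hsub hsuper hA0 hl hη hmax hp hq
    hqi hpi hqpi
  have hls : l₁ - l₂ ≤ s := by
    have h1 : L * ∫ z, ‖j₁ q z - j₁ p z‖ ^ 2 ∂μ₁ ≤ s / 4 := by
      have h := mul_le_mul_of_nonneg_left hqpC hL0
      have h' : L * (s / (4 * (L + 1))) ≤ s / 4 := by
        rw [← mul_div_assoc, div_le_div_iff₀ (by positivity) (by positivity)]
        nlinarith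
      linarith
    have h2 : 2 * η * ∫ z, ‖j₁ q z‖ ^ 2 ∂μ₁ ≤ s / 4 := by
      rw [lt_div_iff₀ (by positivity)] at hη6
      have h := mul_le_mul_of_nonneg_left hqC hη.le
      linarith
    have h3 : 2 * η * V ≤ s / 4 := by
      rw [lt_div_iff₀ (by positivity)] at hη7
      linarith
    linarith
  have hl₁r : |l₁| ≤ (L + 2) * (CJ + CJ) + 2 * C * V := by
    refine hl₁.trans (add_le_add ?_ le_rfl)
    have h0 : 0 ≤ ∫ z, ‖j₁ q z‖ ^ 2 ∂μ₁ := integral_nonneg fun z => by positivity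
    have h0' : 0 ≤ ∫ z, ‖j₁ p z‖ ^ 2 ∂μ₁ := integral_nonneg fun z => by positivity
    exact mul_le_mul (by linarith) (add_le_add hqC hpC) (by linarith) (by linarith)
  have hl₁s : |l₁ - s| ≤ r := by
    have h := abs_sub l₁ s
    rw [abs_of_pos hs0] at h
    linarith
  have hdist : ‖q - p‖ + |l₁ - (l₁ - s)| = ‖q - p‖ + s := by
    rw [sub_sub_cancel, abs_of_pos hs0]
  have hF₁ := hFω (v y) q p l₁ (l₁ - s) (hv y) (by linarith) (by linarith) (by linarith) hl₁s
  rw [hdist] at hF₁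
  have hωlt : ωF (‖q - p‖ + s) < γ * m / 8 :=
    hωt ⟨by linarith [norm_nonneg (q - p)], by linarith⟩
  have hF₂ := hFγ (u x) (v y) q l₁ (abs_le.1 (hv y)).1 (by linarith) (abs_le.1 (hu x)).2
  have hF₃ := hF1m (v y) p (l₁ - s) l₂ (by linarith)
  have hf₁ := hfδ (by rw [dist_eq_norm]; exact hclose _ hxy : dist x y < δf)
  rw [Real.dist_eq] at hf₁
  have h1 := (abs_le.1 hF₁).1
  have h2 := (abs_lt.1 hf₁).2
  have h3 : γ * (m / 2) ≤ γ * (u x - v y) := mul_le_mul_of_nonneg_left (by linarith) hγ.le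
  linarith
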